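/- There exists an absolute constant c > 0 (chosen sufficiently small) with the following property. Assume ‖Z_t‖ ≤ 2√‖X‖, ‖Z_tQ_{t,⊥}‖ ≤ min{2σ_min(Z_tQ_t), c√(σ_min(X))}, ‖Δ_t‖ ≤ cσ_min(X), μ ≤ c/(‖X‖κ), ‖Z̃_tᵀZ_tQ_{t,⊥}‖ ≤ (c/κ)σ_min(Z_tQ_t)√‖X‖, and ‖L_{X,⊥}ᵀP_{Z_tQ_t}‖ ≤ c/κ. Then ‖Z̃_{t+1}ᵀP_{Z_{t+1}Q_{t+1}}‖ ≤ (1 − (μ/4)σ_min(X)) · ‖Z̃_tᵀP_{Z_tQ_t}‖ + 4μ‖X‖·‖Z_tQ_{t,⊥}‖ + 2μ‖Z̃_tᵀZ_t‖·√‖X‖ + μ‖Z̃_tᵀZ_tQ_{t,⊥}‖·σ_min(X)/σ_min(Z_tQ_t) + 800μ²‖X‖^{5/2}. -/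

import Mathlib

open Matrix MeasureTheory ProbabilityTheory

noncomputable section

namespace AsymMatrixSensing

/-- Euclidean norm of a real vector. -/
def euclNorm {ι : Type*} [Fintype ι] (v : ι → ℝ) : ℝ :=
  Real.sqrt (∑ i, v i ^ 2)

/-- Spectral norm of a real matrix. -/
def specNorm {ι₁ ι₂ : Type*} [Fintype ι₁] [Fintype ι₂] (M : Matrix ι₁ ι₂ ℝ) : ℝ :=
  sSup {c : ℝ | ∃ x : ι₂ → ℝ, euclNorm x ≤ 1 ∧ c = euclNorm (M.mulVec x)}

/-- Frobenius norm of a real matrix. -/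
def frobNorm {ι₁ ι₂ : Type*} [Fintype ι₁] [Fintype ι₂] (M : Matrix ι₁ ι₂ ℝ) : ℝ :=
  Real.sqrt (∑ i, ∑ j, M i j ^ 2)

/-- Nuclear norm of a real matrix (characterized by duality with the spectral norm). -/
def nucNorm {ι₁ ι₂ : Type*} [Fintype ι₁] [Fintype ι₂] (M : Matrix ι₁ ι₂ ℝ) : ℝ :=
  sSup {c : ℝ | ∃ B : Matrix ι₁ ι₂ ℝ, specNorm B ≤ 1 ∧ c = ∑ i, ∑ j, M i j * B i j}

/-- Smallest singular value `σ_{min(a,b)}(M)` of a matrix. -/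
def sigmaMin {ι₁ ι₂ : Type*} [Fintype ι₁] [Fintype ι₂] (M : Matrix ι₁ ι₂ ℝ) : ℝ :=
  max (sInf {c : ℝ | ∃ x : ι₂ → ℝ, euclNorm x = 1 ∧ c = euclNorm (M.mulVec x)})
      (sInf {c : ℝ | ∃ y : ι₁ → ℝ, euclNorm y = 1 ∧ c = euclNorm (Mᵀ.mulVec y)})

/-- Smallest nonzero singular value `σ_rank(M)`: the minimum of `‖Mx‖` over unit
vectors `x` orthogonal to the kernel of `M`. -/
def sigmaPos {ι₁ ι₂ : Type*} [Fintype ι₁] [Fintype ι₂] (M : Matrix ι₁ ι₂ ℝ) : ℝ :=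
  sInf {c : ℝ | ∃ x : ι₂ → ℝ, euclNorm x = 1 ∧
    (∀ y : ι₂ → ℝ, M.mulVec y = 0 → x ⬝ᵥ y = 0) ∧ c = euclNorm (M.mulVec x)}

/-- Condition number `κ = ‖M‖ / σ_min(M)`. -/
def condNum {ι₁ ι₂ : Type*} [Fintype ι₁] [Fintype ι₂] (M : Matrix ι₁ ι₂ ℝ) : ℝ :=
  specNorm M / sigmaPos M

/-- Trace inner product `⟨M, N⟩ = trace(Mᵀ N)`. -/
def minner {ι₁ ι₂ : Type*} [Fintype ι₁] [Fintype ι₂] (M N : Matrix ι₁ ι₂ ℝ) : ℝ :=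
  ∑ i, ∑ j, M i j * N i j

/-- `P` is a matrix with orthonormal columns spanning the column space of `M`. -/
def IsOrthCol {ι κ₁ κ₂ : Type*} [Fintype ι] [Fintype κ₁] [Fintype κ₂] [DecidableEq κ₂]
    (P : Matrix ι κ₂ ℝ) (M : Matrix ι κ₁ ℝ) : Prop :=
  Pᵀ * P = 1 ∧ (∃ C : Matrix κ₁ κ₂ ℝ, P = M * C) ∧ P * Pᵀ * M = M

/-- `L` has orthonormal columns spanning the subspace spanned by eigenvectors of the
symmetric matrix `F` corresponding to its `r` largest eigenvalues. -/
def IsTopEigenspace {ι : Type*} [Fintype ι] [DecidableEq ι] {r : ℕ} (F : Matrix ι ι ℝ)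
    (L : Matrix ι (Fin r) ℝ) : Prop :=
  Lᵀ * L = 1 ∧ ∃ d : Fin r → ℝ, F * L = L * Matrix.diagonal d ∧
    ∀ (v : ι → ℝ) (lam : ℝ), v ≠ 0 → F.mulVec v = lam • v →
      Lᵀ.mulVec v = 0 → ∀ i, lam ≤ d i

variable {n₁ n₂ m k r : ℕ}

/-- The measurement operator `𝒜`, given by `[𝒜(Z)]ᵢ = ⟨Aᵢ, Z⟩`. -/
def calA (A : Fin m → Matrix (Fin n₁) (Fin n₂) ℝ) (Z : Matrix (Fin n₁) (Fin n₂) ℝ) :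
    Fin m → ℝ := fun i => minner (A i) Z

/-- The restricted isometry property of order `s` with constant `δ`. -/
def HasRIP (A : Fin m → Matrix (Fin n₁) (Fin n₂) ℝ) (s : ℕ) (δ : ℝ) : Prop :=
  ∀ M : Matrix (Fin n₁) (Fin n₂) ℝ, M.rank ≤ s →
    (1 - δ) * frobNorm M ^ 2 ≤ ∑ i, calA A M i ^ 2 ∧
      ∑ i, calA A M i ^ 2 ≤ (1 + δ) * frobNorm M ^ 2

/-- `𝒜*𝒜`. -/
def AstarA (A : Fin m → Matrix (Fin n₁) (Fin n₂) ℝ) (Z : Matrix (Fin n₁) (Fin n₂) ℝ) :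
    Matrix (Fin n₁) (Fin n₂) ℝ := ∑ i, minner (A i) Z • A i

/-- The symmetrization `sym(X) = [[0, X], [Xᵀ, 0]]`. -/
def symMat (X : Matrix (Fin n₁) (Fin n₂) ℝ) :
    Matrix (Fin n₁ ⊕ Fin n₂) (Fin n₁ ⊕ Fin n₂) ℝ := Matrix.fromBlocks 0 X Xᵀ 0

/-- The symmetrized measurement matrices `Bᵢ = (1/√2)[[0, Aᵢ], [Aᵢᵀ, 0]]`. -/
def Bmat (A : Fin m → Matrix (Fin n₁) (Fin n₂) ℝ) (i : Fin m) :
    Matrix (Fin n₁ ⊕ Fin n₂) (Fin n₁ ⊕ Fin n₂) ℝ :=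
  (Real.sqrt 2)⁻¹ • Matrix.fromBlocks 0 (A i) (A i)ᵀ 0

/-- `ℬ*ℬ`. -/
def BstarB (A : Fin m → Matrix (Fin n₁) (Fin n₂) ℝ)
    (S : Matrix (Fin n₁ ⊕ Fin n₂) (Fin n₁ ⊕ Fin n₂) ℝ) :
    Matrix (Fin n₁ ⊕ Fin n₂) (Fin n₁ ⊕ Fin n₂) ℝ :=
  ∑ i, minner (Bmat A i) S • Bmat A i

/-- The factorized gradient descent iterates `(V_t, W_t)`. -/
def iter (A : Fin m → Matrix (Fin n₁) (Fin n₂) ℝ) (X : Matrix (Fin n₁) (Fin n₂) ℝ)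
    (μ : ℝ) (V₀ : Matrix (Fin n₁) (Fin k) ℝ) (W₀ : Matrix (Fin n₂) (Fin k) ℝ) :
    ℕ → Matrix (Fin n₁) (Fin k) ℝ × Matrix (Fin n₂) (Fin k) ℝ
  | 0 => (V₀, W₀)
  | t + 1 =>
    let p := iter A X μ V₀ W₀ t
    let G := AstarA A (p.1 * p.2ᵀ - X)
    (p.1 - μ • (G * p.2), p.2 - μ • (Gᵀ * p.1))

/-- The vertical stacking `(1/√2)[V; W]`. -/
def Zstack {κ : ℕ} (V : Matrix (Fin n₁) (Fin κ) ℝ) (W : Matrix (Fin n₂) (Fin κ) ℝ) :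
    Matrix (Fin n₁ ⊕ Fin n₂) (Fin κ) ℝ :=
  (Real.sqrt 2)⁻¹ • Matrix.fromRows V W

/-- `Z_t = (1/√2)[V_t; W_t]`. -/
def Zit (A : Fin m → Matrix (Fin n₁) (Fin n₂) ℝ) (X : Matrix (Fin n₁) (Fin n₂) ℝ)
    (μ : ℝ) (V₀ : Matrix (Fin n₁) (Fin k) ℝ) (W₀ : Matrix (Fin n₂) (Fin k) ℝ) (t : ℕ) :
    Matrix (Fin n₁ ⊕ Fin n₂) (Fin k) ℝ :=
  Zstack (iter A X μ V₀ W₀ t).1 (iter A X μ V₀ W₀ t).2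

/-- `Z̃_t = (1/√2)[V_t; −W_t]`. -/
def Ztil (A : Fin m → Matrix (Fin n₁) (Fin n₂) ℝ) (X : Matrix (Fin n₁) (Fin n₂) ℝ)
    (μ : ℝ) (V₀ : Matrix (Fin n₁) (Fin k) ℝ) (W₀ : Matrix (Fin n₂) (Fin k) ℝ) (t : ℕ) :
    Matrix (Fin n₁ ⊕ Fin n₂) (Fin k) ℝ :=
  Zstack (iter A X μ V₀ W₀ t).1 (-(iter A X μ V₀ W₀ t).2)

/-- `Δ_t = (Id − ℬ*ℬ)(Z_tZ_tᵀ − Z̃_tZ̃_tᵀ − sym(X))`. -/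
def Δit (A : Fin m → Matrix (Fin n₁) (Fin n₂) ℝ) (X : Matrix (Fin n₁) (Fin n₂) ℝ)
    (μ : ℝ) (V₀ : Matrix (Fin n₁) (Fin k) ℝ) (W₀ : Matrix (Fin n₂) (Fin k) ℝ) (t : ℕ) :
    Matrix (Fin n₁ ⊕ Fin n₂) (Fin n₁ ⊕ Fin n₂) ℝ :=
  let D := Zit A X μ V₀ W₀ t * (Zit A X μ V₀ W₀ t)ᵀ
    - Ztil A X μ V₀ W₀ t * (Ztil A X μ V₀ W₀ t)ᵀ - symMat X
  D - BstarB A D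

/-- The block diagonal matrix `diag(Id_{n₁}, −Id_{n₂})`. -/
def flipSign (n₁ n₂ : ℕ) : Matrix (Fin n₁ ⊕ Fin n₂) (Fin n₁ ⊕ Fin n₂) ℝ :=
  Matrix.fromBlocks 1 0 0 (-1)

/-- Product Gaussian measure modelling the random initialization pair `(V, W)`
with i.i.d. standard Gaussian entries. -/
def gaussPair (n₁ n₂ k : ℕ) :
    Measure ((Fin n₁ → Fin k → ℝ) × (Fin n₂ → Fin k → ℝ)) :=
  (Measure.pi fun _ : Fin n₁ => Measure.pi fun _ : Fin k => gaussianReal 0 1).prod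
    (Measure.pi fun _ : Fin n₂ => Measure.pi fun _ : Fin k => gaussianReal 0 1)

section Core
set_option linter.unusedSectionVars false
open scoped Matrix.Norms.L2Operator

section vec
variable {ι κ₁ κ₂ : Type*} [Fintype ι] [Fintype κ₁] [Fintype κ₂] [DecidableEq ι] [DecidableEq κ₁] [DecidableEq κ₂]

lemma eucl_eq (v : ι → ℝ) : euclNorm v = ‖WithLp.toLp 2 v‖ := by
  rw [euclNorm, EuclideanSpace.norm_eq]; simp

lemma eucl_nonneg (v : ι → ℝ) : 0 ≤ euclNorm v := Real.sqrt_nonneg _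

lemma eucl_sq (v : ι → ℝ) : euclNorm v ^ 2 = v ⬝ᵥ v := by
  rw [euclNorm, Real.sq_sqrt (Finset.sum_nonneg fun i _ => sq_nonneg _)]
  simp [dotProduct, sq]

lemma mulVec_le (M : Matrix ι κ₁ ℝ) (x : κ₁ → ℝ) : euclNorm (M.mulVec x) ≤ ‖M‖ * euclNorm x := by
  rw [eucl_eq, eucl_eq]
  exact Matrix.l2_opNorm_mulVec M (WithLp.toLp 2 x)

lemma norm_le_of_vec (M : Matrix ι κ₁ ℝ) (c : ℝ) (hc : 0 ≤ c)
    (h : ∀ x, euclNorm (M.mulVec x) ≤ c * euclNorm x) : ‖M‖ ≤ c := by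
  rw [Matrix.l2_opNorm_def]
  refine ContinuousLinearMap.opNorm_le_bound _ hc fun x => ?_
  have := h (WithLp.ofLp x)
  rw [eucl_eq, eucl_eq] at this
  exact this

lemma eucl_smul (a : ℝ) (v : ι → ℝ) : euclNorm (a • v) = |a| * euclNorm v := by
  rw [eucl_eq, eucl_eq, WithLp.toLp_smul, norm_smul, Real.norm_eq_abs]

lemma eucl_zero : euclNorm (0 : ι → ℝ) = 0 := by simp [euclNorm]

lemma eucl_eq_zero {v : ι → ℝ} (h : euclNorm v = 0) : v = 0 := by
  have := eucl_sq v
  rw [h] at this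
  exact dotProduct_self_eq_zero.1 (by simpa using this.symm)

lemma specNorm_eq (M : Matrix ι κ₁ ℝ) : specNorm M = ‖M‖ := by
  have hb : BddAbove {c : ℝ | ∃ x : κ₁ → ℝ, euclNorm x ≤ 1 ∧ c = euclNorm (M.mulVec x)} := by
    refine ⟨‖M‖, ?_⟩
    rintro c ⟨x, hx, rfl⟩
    exact (mulVec_le M x).trans (mul_le_of_le_one_right (norm_nonneg _) hx)
  apply le_antisymm
  · apply csSup_le
    · exact ⟨_, 0, by simp [eucl_zero], rfl⟩
    · rintro c ⟨x, hx, rfl⟩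
      exact (mulVec_le M x).trans (mul_le_of_le_one_right (norm_nonneg _) hx)
  · have h0 : 0 ≤ specNorm M := le_csSup hb ⟨0, by simp [eucl_zero], by simp [eucl_zero]⟩
    apply norm_le_of_vec _ _ h0
    intro x
    by_cases hx : euclNorm x = 0
    · rw [eucl_eq_zero hx]; simp [eucl_zero]
    have hp : 0 < euclNorm x := lt_of_le_of_ne (eucl_nonneg x) (Ne.symm hx)
    have : euclNorm (M.mulVec ((euclNorm x)⁻¹ • x)) ≤ specNorm M :=
      le_csSup hb ⟨_, by rw [eucl_smul, abs_of_pos (inv_pos.2 hp), inv_mul_cancel₀ hx], rfl⟩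
    rw [Matrix.mulVec_smul, eucl_smul, abs_of_pos (inv_pos.2 hp)] at this
    rw [inv_mul_le_iff₀ hp] at this
    linarith

lemma nT (M : Matrix ι κ₁ ℝ) : ‖Mᵀ‖ = ‖M‖ := by
  rw [← Matrix.conjTranspose_eq_transpose_of_trivial, Matrix.l2_opNorm_conjTranspose]

lemma nTM (M : Matrix ι κ₁ ℝ) : ‖Mᵀ * M‖ = ‖M‖ * ‖M‖ := by
  rw [← Matrix.conjTranspose_eq_transpose_of_trivial, Matrix.l2_opNorm_conjTranspose_mul_self]

lemma n1 : ‖(1 : Matrix ι ι ℝ)‖ ≤ 1 := by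
  have h := nTM (1 : Matrix ι ι ℝ)
  simp only [transpose_one, mul_one] at h
  nlinarith [norm_nonneg (1 : Matrix ι ι ℝ)]

lemma north {U : Matrix ι κ₁ ℝ} (h : Uᵀ * U = 1) : ‖U‖ ≤ 1 := by
  have h1 := nTM U
  rw [h] at h1
  have := n1 (ι := κ₁)
  nlinarith [norm_nonneg U]

lemma nm {M : Matrix ι κ₁ ℝ} {L : Matrix κ₁ κ₂ ℝ} {a b : ℝ} (h1 : ‖M‖ ≤ a) (h2 : ‖L‖ ≤ b) :
    ‖M * L‖ ≤ a * b :=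
  (Matrix.l2_opNorm_mul _ _).trans
    (mul_le_mul h1 h2 (norm_nonneg _) ((norm_nonneg _).trans h1))

lemma ntr {M : Matrix ι κ₁ ℝ} {a : ℝ} (h1 : ‖M‖ ≤ a) : ‖Mᵀ‖ ≤ a := by rwa [nT]

lemma nsm {M : Matrix ι κ₁ ℝ} {a μ : ℝ} (hμ : 0 ≤ μ) (h1 : ‖M‖ ≤ a) : ‖μ • M‖ ≤ μ * a := by
  rw [norm_smul, Real.norm_of_nonneg hμ]; gcongr

lemma npsd (R : Matrix ι κ₁ ℝ) (t : ℝ) (h : ‖R‖ * ‖R‖ ≤ t) :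
    ‖t • (1 : Matrix κ₁ κ₁ ℝ) - Rᵀ * R‖ ≤ t := by
  have ht : 0 ≤ t := (mul_self_nonneg _).trans h
  apply norm_le_of_vec _ _ ht
  intro x
  apply le_of_sq_le_sq _ (mul_nonneg ht (eucl_nonneg x))
  rw [mul_pow, eucl_sq, eucl_sq, Matrix.sub_mulVec, Matrix.smul_mulVec, Matrix.one_mulVec,
    ← Matrix.mulVec_mulVec]
  have e1 : x ⬝ᵥ (Rᵀ *ᵥ (R *ᵥ x)) = (R *ᵥ x) ⬝ᵥ (R *ᵥ x) := by
    rw [Matrix.dotProduct_mulVec, Matrix.vecMul_transpose]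
  have e2 := mulVec_le Rᵀ (R *ᵥ x)
  rw [nT] at e2
  have e3 := pow_le_pow_left₀ (eucl_nonneg _) e2 2
  rw [mul_pow, eucl_sq, eucl_sq] at e3
  have e4 : 0 ≤ (R *ᵥ x) ⬝ᵥ (R *ᵥ x) := by rw [← eucl_sq]; positivity
  have e5 : ‖R‖ ^ 2 * ((R *ᵥ x) ⬝ᵥ (R *ᵥ x)) ≤ t * ((R *ᵥ x) ⬝ᵥ (R *ᵥ x)) := by
    gcongr; nlinarith
  simp only [sub_dotProduct, dotProduct_sub, smul_dotProduct, dotProduct_smul, smul_eq_mul]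
  rw [dotProduct_comm (Rᵀ *ᵥ (R *ᵥ x)) x, e1]
  nlinarith [mul_nonneg ht e4]

/-- near-isometries are invertible. -/
lemma near_inv (T : Matrix ι ι ℝ) (h : ‖1 - Tᵀ * T‖ ≤ 1 / 2) :
    ∃ D : Matrix ι ι ℝ, D * T = 1 ∧ T * D = 1 ∧ ‖D‖ ≤ 2 := by
  have hu : IsUnit (Tᵀ * T) := by
    have := isUnit_one_sub_of_norm_lt_one (x := 1 - Tᵀ * T) (lt_of_le_of_lt h (by norm_num))
    simpa using this
  obtain ⟨u, hu⟩ := hu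
  have hDT : ((u⁻¹ : (Matrix ι ι ℝ)ˣ) : Matrix ι ι ℝ) * Tᵀ * T = 1 := by
    rw [Matrix.mul_assoc, ← hu]; simp
  set D := ((u⁻¹ : (Matrix ι ι ℝ)ˣ) : Matrix ι ι ℝ) * Tᵀ with hD
  have hTD : T * D = 1 := mul_eq_one_comm.1 hDT
  refine ⟨D, hDT, hTD, ?_⟩
  have e : Dᵀ * D = 1 + Dᵀ * (1 - Tᵀ * T) * D := by
    have : (T * D)ᵀ * (T * D) = 1 := by rw [hTD]; simp
    rw [transpose_mul] at this
    have e' : Dᵀ * (1 - Tᵀ * T) * D = Dᵀ * D - Dᵀ * Tᵀ * (T * D) := by noncomm_ring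
    rw [e', this]; abel
  have e2 : ‖Dᵀ * D‖ ≤ 1 + ‖D‖ * (1 / 2) * ‖D‖ := by
    rw [e]
    exact (norm_add_le _ _).trans (add_le_add n1 (nm (nm (nT D).le h) le_rfl))
  rw [nTM] at e2
  nlinarith [norm_nonneg D]

end vec

section core
variable {n k r p kp : Type*} [Fintype n] [Fintype k] [Fintype r] [Fintype p] [Fintype kp]
  [DecidableEq n] [DecidableEq k] [DecidableEq r] [DecidableEq p] [DecidableEq kp]

lemma core_struct (LX : Matrix n r ℝ) (W : Matrix n n ℝ) (Z : Matrix n k ℝ)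
    (Qt : Matrix k r ℝ) (Qtp : Matrix k kp ℝ) (Qs : Matrix k r ℝ) (U PZs : Matrix n r ℝ)
    (C S D C2 : Matrix r r ℝ)
    (hQ : Qt * Qtᵀ + Qtp * Qtpᵀ = 1)
    (hQs2 : LXᵀ * (W * Z) * Qs * Qsᵀ = LXᵀ * (W * Z))
    (hUS : Z * Qt = U * S) (hCS : C * S = 1) (hD : D * (LXᵀ * W * U) = 1)
    (hP : PZs = W * Z * Qs * C2) :
    ∃ w : Matrix r r ℝ,
      PZs = W * (U + Z * Qtp * (C * (D * (LXᵀ * W * (Z * Qtp))))ᵀ * C) * w := by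
  have h1 : LXᵀ * (W * Z) * Qs * (Qsᵀ * Qt) = LXᵀ * W * U * S := by
    rw [← Matrix.mul_assoc, hQs2, Matrix.mul_assoc, Matrix.mul_assoc W, hUS]
    simp only [Matrix.mul_assoc]
  have h2 : LXᵀ * (W * Z) * Qs * (Qsᵀ * Qtp) = LXᵀ * W * (Z * Qtp) := by
    rw [← Matrix.mul_assoc, hQs2]
    simp only [Matrix.mul_assoc]
  have h3 : (C * (D * (LXᵀ * (W * Z) * Qs))) * (Qsᵀ * Qt) = 1 := by
    rw [Matrix.mul_assoc, Matrix.mul_assoc D, h1, ← Matrix.mul_assoc D, hD, Matrix.one_mul, hCS]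
  have h4 : (Qsᵀ * Qt) * (C * (D * (LXᵀ * (W * Z) * Qs))) = 1 := mul_eq_one_comm.1 h3
  have h5 : Qsᵀ * Qtp = (Qsᵀ * Qt) * (C * (D * (LXᵀ * W * (Z * Qtp)))) := by
    rw [← h2, ← Matrix.mul_assoc D, ← Matrix.mul_assoc C, ← Matrix.mul_assoc (Qsᵀ * Qt), h4,
      Matrix.one_mul]
  set E := (C * (D * (LXᵀ * W * (Z * Qtp))))ᵀ with hE
  have h6 : Qtpᵀ * Qs = E * (Qtᵀ * Qs) := by
    have := congrArg Matrix.transpose h5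
    rw [transpose_mul, transpose_mul, transpose_transpose, transpose_mul Qsᵀ Qt,
      transpose_transpose] at this
    exact this
  have h7 : Qs = Qt * (Qtᵀ * Qs) + Qtp * (E * (Qtᵀ * Qs)) := by
    rw [← h6, ← Matrix.mul_assoc, ← Matrix.mul_assoc, ← Matrix.add_mul, hQ, Matrix.one_mul]
  refine ⟨S * (Qtᵀ * Qs) * C2, ?_⟩
  have h8 : Z * Qs = (U + Z * Qtp * E * C) * (S * (Qtᵀ * Qs)) := by
    conv_lhs => rw [h7]
    rw [Matrix.mul_add, Matrix.add_mul, ← Matrix.mul_assoc, hUS]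
    congr 1
    · simp only [Matrix.mul_assoc]
    · rw [Matrix.mul_assoc _ C, ← Matrix.mul_assoc C, hCS, Matrix.one_mul]
      simp only [Matrix.mul_assoc]
  rw [hP, Matrix.mul_assoc W, h8]
  simp only [Matrix.mul_assoc]

lemma core_contr (SX : Matrix n n ℝ) (LX Lt U : Matrix n r ℝ) (LXp : Matrix n p ℝ) (σX : r → ℝ)
    (N σ μ ε : ℝ) (hSX : SX = LX * diagonal σX * LXᵀ - Lt * diagonal σX * Ltᵀ)
    (hL : LX * LXᵀ + LXp * LXpᵀ = 1) (hLt : Ltᵀ * LX = 0) (hLtn : ‖Lt‖ ≤ 1) (hLXpn : ‖LXp‖ ≤ 1)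
    (hU : Uᵀ * U = 1) (h1 : ∀ i, σ ≤ σX i) (h2 : ∀ i, σX i ≤ N) (hσ : 0 < σ) (hN : σ ≤ N) (hμ : 0 < μ)
    (hμN : μ * N ≤ 1) (hε0 : 0 ≤ ε) (hε1 : ε ≤ 1) (hε : N * ε ≤ σ)
    (hJ : ‖LXpᵀ * U‖ ≤ ε) :
    ‖1 - μ • (Uᵀ * SX * U)‖ ≤ 1 - μ * σ + 2 * ε * (μ * σ) := by
  have hq : 0 < μ * σ := mul_pos hμ hσ
  set J1 := LXᵀ * U with hJ1
  set J3 := LXpᵀ * U with hJ3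
  have hJJ : J1ᵀ * J1 + J3ᵀ * J3 = 1 := by
    rw [← hU, hJ1, hJ3, transpose_mul, transpose_mul, transpose_transpose, transpose_transpose]
    have : Uᵀ * (LX * LXᵀ + LXp * LXpᵀ) * U = Uᵀ * U := by rw [hL, Matrix.mul_one]
    rw [← this]
    simp only [Matrix.mul_assoc, Matrix.mul_add, Matrix.add_mul]
  have hJ2 : Ltᵀ * U = Ltᵀ * LXp * J3 := by
    have : Ltᵀ * (LX * LXᵀ + LXp * LXpᵀ) * U = Ltᵀ * U := by rw [hL, Matrix.mul_one]
    rw [← this, Matrix.mul_add, ← Matrix.mul_assoc, hLt, Matrix.zero_mul, zero_add]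
    simp only [hJ3, Matrix.mul_assoc]
  set J2 := Ltᵀ * U with hJ2d
  have hJ2n : ‖J2‖ ≤ 1 * 1 * ε := by
    rw [hJ2]; exact nm (nm (ntr hLtn) hLXpn) hJ
  have hJ1n : ‖J1‖ * ‖J1‖ ≤ 1 := by
    have h := npsd J3 1 (by nlinarith [norm_nonneg J3])
    rw [one_smul, ← hJJ, add_sub_cancel_right, nTM] at h
    exact h
  set R := diagonal (fun i => Real.sqrt (μ * (σX i - σ))) * J1 with hR
  have hRR : Rᵀ * R = μ • (J1ᵀ * diagonal σX * J1) - (μ * σ) • (J1ᵀ * J1) := by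
    have e : (diagonal (fun i => Real.sqrt (μ * (σX i - σ))) : Matrix r r ℝ) *
        diagonal (fun i => Real.sqrt (μ * (σX i - σ))) =
        μ • diagonal σX - (μ * σ) • (1 : Matrix r r ℝ) := by
      rw [diagonal_mul_diagonal]
      ext i j
      by_cases hij : i = j
      · subst hij
        have : 0 ≤ μ * (σX i - σ) := mul_nonneg hμ.le (sub_nonneg.2 (h1 i))
        simp [Real.mul_self_sqrt this]; ring
      · simp [hij]
    rw [hR, transpose_mul, diagonal_transpose, Matrix.mul_assoc, ← Matrix.mul_assoc _ _ J1, e]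
    simp only [Matrix.sub_mul, Matrix.mul_sub, Matrix.smul_mul, Matrix.mul_smul, Matrix.one_mul,
      Matrix.mul_assoc]
  have hRn : ‖R‖ * ‖R‖ ≤ 1 - μ * σ := by
    have hd : ‖(diagonal (fun i => Real.sqrt (μ * (σX i - σ))) : Matrix r r ℝ)‖
        ≤ Real.sqrt (μ * (N - σ)) := by
      rw [Matrix.l2_opNorm_diagonal, pi_norm_le_iff_of_nonneg (Real.sqrt_nonneg _)]
      intro i
      rw [Real.norm_of_nonneg (Real.sqrt_nonneg _)]
      apply Real.sqrt_le_sqrt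
      have := h2 i
      gcongr
    have h := nm hd (le_refl ‖J1‖)
    have hs := Real.mul_self_sqrt (mul_nonneg hμ.le (sub_nonneg.2 hN))
    calc ‖R‖ * ‖R‖ ≤ (Real.sqrt (μ * (N - σ)) * ‖J1‖) * (Real.sqrt (μ * (N - σ)) * ‖J1‖) := by
          gcongr
      _ = (μ * (N - σ)) * (‖J1‖ * ‖J1‖) := by
          rw [mul_mul_mul_comm, hs]
      _ ≤ (μ * (N - σ)) * 1 := by
          apply mul_le_mul_of_nonneg_left hJ1n (mul_nonneg hμ.le (sub_nonneg.2 hN))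
      _ ≤ _ := by linarith
  have hdec : 1 - μ • (Uᵀ * SX * U) = ((1 - μ * σ) • (1 : Matrix r r ℝ) - Rᵀ * R)
      + (μ * σ) • (J3ᵀ * J3) + μ • (J2ᵀ * diagonal σX * J2) := by
    have e1 : Uᵀ * SX * U = J1ᵀ * diagonal σX * J1 - J2ᵀ * diagonal σX * J2 := by
      rw [hSX, hJ1, hJ2d, transpose_mul, transpose_mul, transpose_transpose, transpose_transpose]
      simp only [Matrix.mul_assoc, Matrix.mul_sub, Matrix.sub_mul]
    have e2 : J3ᵀ * J3 = 1 - J1ᵀ * J1 := by rw [← hJJ]; abel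
    rw [e1, hRR, e2]
    module
  have hSg : ‖(diagonal σX : Matrix r r ℝ)‖ ≤ N := by
    rw [Matrix.l2_opNorm_diagonal, pi_norm_le_iff_of_nonneg (hσ.le.trans hN)]
    intro i
    rw [Real.norm_of_nonneg (hσ.le.trans (h1 i))]
    exact h2 i
  have b1 := npsd R _ hRn
  have b2 := nsm hq.le (nm (ntr hJ) hJ)
  have b3 := nsm hμ.le (nm (nm (ntr hJ2n) hSg) hJ2n)
  rw [hdec]
  refine (norm_add₃_le.trans (add_le_add (add_le_add b1 b2) b3)).trans ?_
  have c1 : μ * σ * (ε * ε) ≤ μ * σ * ε :=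
    mul_le_mul_of_nonneg_left (by nlinarith) hq.le
  have c2 : μ * (1 * 1 * ε * N * (1 * 1 * ε)) ≤ μ * σ * ε := by
    have : (N * ε) * (μ * ε) ≤ σ * (μ * ε) := mul_le_mul_of_nonneg_right hε (by positivity)
    linarith
  linarith

lemma gram (LX U : Matrix n r ℝ) (LXp : Matrix n p ℝ) (hL : LX * LXᵀ + LXp * LXpᵀ = 1)
    (hU : Uᵀ * U = 1) :
    (LXᵀ * U)ᵀ * (LXᵀ * U) + (LXpᵀ * U)ᵀ * (LXpᵀ * U) = 1 := by
  rw [transpose_mul, transpose_mul, transpose_transpose, transpose_transpose]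
  have : Uᵀ * (LX * LXᵀ + LXp * LXpᵀ) * U = 1 := by rw [hL, Matrix.mul_one, hU]
  rw [← this]
  simp only [Matrix.mul_assoc, Matrix.mul_add, Matrix.add_mul]

lemma core_T (LX U : Matrix n r ℝ) (LXp : Matrix n p ℝ) (M : Matrix n n ℝ)
    (hL : LX * LXᵀ + LXp * LXpᵀ = 1) (hLX : ‖LX‖ ≤ 1)
    (hU : Uᵀ * U = 1) (hM : ‖M‖ ≤ 1 / 100) (hJ : ‖LXpᵀ * U‖ ≤ 1 / 100) :
    ∃ D : Matrix r r ℝ, D * (LXᵀ * (1 + M) * U) = 1 ∧ ‖D‖ ≤ 2 := by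
  have hg := gram LX U LXp hL hU
  have hJ1 := nm (ntr hLX) (north hU)
  set J1 := LXᵀ * U
  set J3 := LXpᵀ * U
  have hP : ‖LXᵀ * M * U‖ ≤ 1 * (1 / 100) * 1 := nm (nm (ntr hLX) hM) (north hU)
  set P := LXᵀ * M * U
  have hT : LXᵀ * (1 + M) * U = J1 + P := by
    simp only [Matrix.mul_add, Matrix.add_mul, Matrix.mul_one, J1, P]
  have hd : 1 - (J1 + P)ᵀ * (J1 + P) = J3ᵀ * J3 - J1ᵀ * P - Pᵀ * J1 - Pᵀ * P := by
    rw [← hg, transpose_add]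
    noncomm_ring
  obtain ⟨D, h1, -, h2⟩ := near_inv (J1 + P) (by
    rw [hd]
    have a1 := nm (ntr hJ) hJ
    have a2 := nm (ntr hJ1) hP
    have a3 := nm (ntr hP) hJ1
    have a4 := nm (ntr hP) hP
    have := norm_sub_le (J3ᵀ * J3 - J1ᵀ * P - Pᵀ * J1) (Pᵀ * P)
    have := norm_sub_le (J3ᵀ * J3 - J1ᵀ * P) (Pᵀ * J1)
    have := norm_sub_le (J3ᵀ * J3) (J1ᵀ * P)
    linarith)
  exact ⟨D, by rw [hT, h1], h2⟩

lemma core_K (SX Δ M : Matrix n n ℝ) (LX Lt U : Matrix n r ℝ) (LXp : Matrix n p ℝ) (σX : r → ℝ)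
    (Z Zt : Matrix n k ℝ) (Qt : Matrix k r ℝ) (Y : Matrix n kp ℝ) (S : Matrix r r ℝ)
    (s0 cσ ε b d : ℝ)
    (hSX : SX = LX * diagonal σX * LXᵀ - Lt * diagonal σX * Ltᵀ)
    (hM : M = SX - Z * Zᵀ + Zt * Ztᵀ + Δ)
    (hL : LX * LXᵀ + LXp * LXpᵀ = 1) (hLX : LXᵀ * LX = 1) (hLt : LXᵀ * Lt = 0) (hLXpn : ‖LXp‖ ≤ 1)
    (hU : Uᵀ * U = 1) (hQt : Qtᵀ * Qt = 1)
    (hUS : Z * Qt = U * S) (hLZ : LXᵀ * Z * Qt * Qtᵀ = LXᵀ * Z)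
    (hLY : LXᵀ * Y = 0) (hZ : ‖Z‖ ≤ 2 * s0) (hZt : ‖Zt‖ ≤ 2 * s0) (hs0 : 0 ≤ s0)
    (hΔ : ‖Δ‖ ≤ cσ) (hb : ‖Y‖ ≤ b) (hd : ‖Ztᵀ * Y‖ ≤ d) (hJ : ‖LXpᵀ * U‖ ≤ ε)
    (hε : s0 * s0 * ε = cσ) :
    ‖LXᵀ * M * Y‖ ≤ 5 * cσ * b + 2 * s0 * d := by
  have hY : Y = LXp * (LXpᵀ * Y) := by
    have : (LX * LXᵀ + LXp * LXpᵀ) * Y = Y := by rw [hL, Matrix.one_mul]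
    rw [Matrix.add_mul, Matrix.mul_assoc, hLY, Matrix.mul_zero, zero_add, Matrix.mul_assoc] at this
    exact this.symm
  have hLn := north hLX
  have hUY : ‖Uᵀ * Y‖ ≤ ε * (1 * b) := by
    have : Uᵀ * Y = (LXpᵀ * U)ᵀ * (LXpᵀ * Y) := by
      rw [transpose_mul, transpose_transpose, Matrix.mul_assoc, ← hY]
    rw [this]
    exact nm (ntr hJ) (nm (ntr hLXpn) hb)
  have e1 : LXᵀ * SX * Y = 0 := by
    have : LXᵀ * SX = diagonal σX * LXᵀ := by
      rw [hSX, Matrix.mul_sub, ← Matrix.mul_assoc, ← Matrix.mul_assoc, hLX, Matrix.one_mul,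
        ← Matrix.mul_assoc, ← Matrix.mul_assoc, hLt]
      simp
    rw [this, Matrix.mul_assoc, hLY, Matrix.mul_zero]
  have e2 : LXᵀ * (Z * Zᵀ) * Y = LXᵀ * ((Z * Qt) * (Z * Qt)ᵀ) * Y := by
    rw [transpose_mul, ← Matrix.mul_assoc, ← hLZ]
    simp only [Matrix.mul_assoc]
  have hZQ : ‖Z * Qt‖ ≤ 2 * s0 * 1 := nm hZ (north hQt)
  have e3 : (Z * Qt)ᵀ * Y = (Z * Qt)ᵀ * U * (Uᵀ * Y) := by
    have : (Z * Qt)ᵀ = (Z * Qt)ᵀ * U * Uᵀ := by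
      rw [hUS, transpose_mul, Matrix.mul_assoc Sᵀ, hU, Matrix.mul_one]
    rw [← Matrix.mul_assoc, ← this]
  have b2 : ‖LXᵀ * (Z * Zᵀ) * Y‖ ≤ 1 * ((2 * s0 * 1) * ((2 * s0 * 1) * 1 * (ε * (1 * b)))) := by
    rw [e2, Matrix.mul_assoc, Matrix.mul_assoc, e3]
    exact nm (ntr hLn) (nm hZQ (nm (nm (ntr hZQ) (north hU)) hUY))
  have b3 : ‖LXᵀ * (Zt * Ztᵀ) * Y‖ ≤ 1 * ((2 * s0) * d) := by
    rw [Matrix.mul_assoc, Matrix.mul_assoc]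
    exact nm (ntr hLn) (nm hZt hd)
  have b4 : ‖LXᵀ * Δ * Y‖ ≤ 1 * cσ * b := nm (nm (ntr hLn) hΔ) hb
  have hdec : LXᵀ * M * Y = LXᵀ * (Zt * Ztᵀ) * Y - LXᵀ * (Z * Zᵀ) * Y + LXᵀ * Δ * Y := by
    rw [hM, Matrix.mul_add, Matrix.mul_add, Matrix.mul_sub, Matrix.add_mul, Matrix.add_mul,
      Matrix.sub_mul, e1]
    abel
  rw [hdec]
  have := norm_add_le (LXᵀ * (Zt * Ztᵀ) * Y - LXᵀ * (Z * Zᵀ) * Y) (LXᵀ * Δ * Y)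
  have := norm_sub_le (LXᵀ * (Zt * Ztᵀ) * Y) (LXᵀ * (Z * Zᵀ) * Y)
  have e5 : 1 * ((2 * s0 * 1) * ((2 * s0 * 1) * 1 * (ε * (1 * b)))) = 4 * cσ * b := by
    rw [← hε]; ring
  linarith

set_option maxHeartbeats 4000000 in
/-- final estimate -/
lemma core_fin (SX Δ M : Matrix n n ℝ) (U F P : Matrix n r ℝ) (w : Matrix r r ℝ)
    (LX : Matrix n r ℝ) (LXp : Matrix n p ℝ)
    (Z Zt : Matrix n k ℝ) (Qt : Matrix k r ℝ) (Qtp : Matrix k kp ℝ) (S : Matrix r r ℝ)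
    (N s0 σ μ c f e : ℝ) (hc : c = 1 / 10000)
    (hM : M = SX - Z * Zᵀ + Zt * Ztᵀ + Δ) (hMT : Mᵀ = M) (hSXn : ‖SX‖ ≤ N)
    (hs0 : 0 ≤ s0) (hN : s0 * s0 = N) (hσ : 0 < σ) (hσN : σ ≤ N) (hμ : 0 < μ)
    (hμ2 : μ * N * N ≤ c * σ)
    (hU : Uᵀ * U = 1) (hP : Pᵀ * P = 1)
    (hPw : P = (1 + μ • M) * (U + F) * w)
    (hQt : Qtᵀ * Qt = 1) (hQtp : Qtpᵀ * Qtp = 1) (hQ : Qt * Qtᵀ + Qtp * Qtpᵀ = 1)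
    (hL : LX * LXᵀ + LXp * LXpᵀ = 1) (hLXpn : ‖LXp‖ ≤ 1)
    (hLY : LXᵀ * (Z * Qtp) = 0)
    (hUS : Z * Qt = U * S)
    (hZ : ‖Z‖ ≤ 2 * s0) (hZt : ‖Zt‖ ≤ 2 * s0) (hΔ : ‖Δ‖ ≤ c * σ)
    (hJ : ‖LXpᵀ * U‖ ≤ c)
    (hB : ‖1 - μ • (Uᵀ * SX * U)‖ ≤ 1 - μ * σ + 2 * c * (μ * σ))
    (hF : ‖F‖ ≤ 48 * c * (μ * σ)) (hZF : ‖Ztᵀ * F‖ ≤ f) (hf : 2 * f ≤ e) :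
    ‖((1 - μ • M) * Zt)ᵀ * P‖ ≤ (1 - μ / 4 * σ) * ‖Ztᵀ * U‖ + 4 * μ * N * ‖Z * Qtp‖
      + 2 * μ * ‖Ztᵀ * Z‖ * s0 + e + 800 * μ ^ 2 * (N ^ 2 * s0) := by
  have hNp : 0 < N := hσ.trans_le hσN
  have hq : 0 < μ * σ := mul_pos hμ hσ
  have hμN : μ * N ≤ c := by
    have : μ * N * N ≤ c * N := hμ2.trans (by rw [hc]; linarith)
    exact le_of_mul_le_mul_right this hNp
  have hμ0 : 0 ≤ μ * N := by positivity
  have hqN : μ * σ ≤ μ * N := by gcongr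
  have hμ2' : (μ * N) * (μ * N) ≤ c * (μ * σ) := by nlinarith
  have hUn := north hU
  have hPn := north hP
  have hMn : ‖M‖ ≤ 10 * N := by
    rw [hM]
    have a1 := nm hZ (ntr hZ)
    have a2 := nm hZt (ntr hZt)
    have := norm_add_le (SX - Z * Zᵀ + Zt * Ztᵀ) Δ
    have := norm_add_le (SX - Z * Zᵀ) (Zt * Ztᵀ)
    have := norm_sub_le SX (Z * Zᵀ)
    have : 2 * s0 * (2 * s0) = 4 * N := by rw [← hN]; ring
    have : c * σ ≤ N := by rw [hc]; linarith
    linarith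
  set q := μ * σ with hqd
  set G := Ztᵀ * U with hG
  have hGn : ‖G‖ ≤ 2 * s0 * 1 := nm (ntr hZt) hUn
  set B := Uᵀ * SX * U with hBd
  have hBn : ‖B‖ ≤ 1 * N * 1 := nm (nm (ntr hUn) hSXn) hUn
  set K := Uᵀ * Z * (Zᵀ * U) with hK
  -- R
  set H := Uᵀ * M * U with hH
  have hHn : ‖H‖ ≤ 1 * (10 * N) * 1 := nm (nm (ntr hUn) hMn) hUn
  set R2 := Uᵀ * F + μ • (Uᵀ * M * F) with hR2
  have hR2n : ‖R2‖ ≤ 100 * c * q := by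
    have a1 := nm (ntr hUn) hF
    have a2 := nsm hμ.le (nm (nm (ntr hUn) hMn) hF)
    have := norm_add_le (Uᵀ * F) (μ • (Uᵀ * M * F))
    have : μ * (1 * (10 * N) * (48 * c * q)) ≤ 10 * c * (48 * c * q) := by
      have : (μ * N) * (480 * c * q) ≤ c * (480 * c * q) := by
        apply mul_le_mul_of_nonneg_right hμN; rw [hc]; positivity
      linarith
    rw [hc] at *
    nlinarith
  set a := Uᵀ * P with ha
  have han : ‖a‖ ≤ 1 * 1 := nm (ntr hUn) hPn
  have haw : w = a - (μ • H + R2) * w := by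
    have : a = (1 + (μ • H + R2)) * w := by
      rw [ha, hPw, hH, hR2, ← hU]
      simp only [Matrix.mul_add, Matrix.add_mul, Matrix.one_mul, Matrix.smul_mul, Matrix.mul_smul,
        Matrix.mul_assoc]
      abel
    rw [this]; noncomm_ring
  have hRn : ‖μ • H + R2‖ ≤ 10 * (μ * N) + 100 * c * q := by
    have := norm_add_le (μ • H) R2
    have := nsm hμ.le hHn
    linarith
  have hqc : q ≤ c := hqN.trans hμN
  have hRn' : ‖μ • H + R2‖ ≤ 1 / 2 := by
    rw [hc] at *; linarith
  have hwn : ‖w‖ ≤ 2 := by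
    have h1 : ‖w‖ ≤ ‖a‖ + ‖(μ • H + R2) * w‖ := by
      conv_lhs => rw [haw]
      exact norm_sub_le _ _
    have h2 := nm hRn' (le_refl ‖w‖)
    linarith
  -- expansion of G * w
  set err := μ • (H * ((μ • H + R2) * w)) - R2 * w with herr
  have hw2 : w = a - μ • (H * a) + err := by
    have h1 : (μ • H + R2) * w = μ • (H * w) + R2 * w := by
      rw [Matrix.add_mul, Matrix.smul_mul]
    have h2 : H * w = H * a - H * ((μ • H + R2) * w) := by
      rw [← Matrix.mul_sub, ← haw]
    have h3 : w = a - (μ • (H * w) + R2 * w) := by rw [← h1]; exact haw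
    conv_lhs => rw [h3, h2]
    rw [herr, smul_sub]
    abel
  have herrn : ‖err‖ ≤ 600 * c * q := by
    have a1 := nsm hμ.le (nm hHn (nm hRn hwn))
    have a2 := nm hR2n hwn
    have := norm_sub_le (μ • (H * ((μ • H + R2) * w))) (R2 * w)
    have e1 : μ * (1 * (10 * N) * 1 * ((10 * (μ * N) + 100 * c * q) * 2))
        = 200 * ((μ * N) * (μ * N)) + 2000 * c * q * (μ * N) := by ring
    have e2 : 2000 * c * q * (μ * N) ≤ 2000 * c * q * c := by
      apply mul_le_mul_of_nonneg_left hμN; rw [hc]; positivity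
    rw [hc] at *
    nlinarith
  have hHd : H = B - K + Gᵀ * G + Uᵀ * Δ * U := by
    rw [hH, hM, hBd, hK, hG, transpose_mul, transpose_transpose]
    simp only [Matrix.mul_add, Matrix.add_mul, Matrix.mul_sub, Matrix.sub_mul, Matrix.mul_assoc]
  have hGw : G * w = (1 - μ • (G * Gᵀ)) * G * (1 - μ • B) * a - G * (Gᵀ * G * ((μ * μ) • B) * a)
      + μ • (G * K * a) - G * (μ • (Uᵀ * Δ * U * a)) + G * err := by
    rw [hw2, hHd]
    simp only [Matrix.mul_add, Matrix.add_mul, Matrix.mul_sub, Matrix.sub_mul, Matrix.mul_assoc,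
      Matrix.smul_mul, Matrix.mul_smul, Matrix.one_mul, Matrix.mul_one, smul_sub, smul_add, smul_smul]
    abel
  have hg0 := norm_nonneg G
  have t1 : ‖(1 - μ • (G * Gᵀ)) * G * (1 - μ • B) * a‖ ≤
      1 * ‖G‖ * (1 - μ * σ + 2 * c * (μ * σ)) * (1 * 1) := by
    refine nm (nm (nm ?_ le_rfl) hB) han
    have h := npsd (Real.sqrt μ • Gᵀ) 1 (by
      rw [norm_smul, nT, Real.norm_of_nonneg (Real.sqrt_nonneg _), mul_mul_mul_comm,
        Real.mul_self_sqrt hμ.le]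
      have : ‖G‖ * ‖G‖ ≤ 4 * N := by nlinarith
      have : μ * (‖G‖ * ‖G‖) ≤ μ * (4 * N) := by gcongr
      rw [hc] at hμN
      linarith)
    rw [transpose_smul, transpose_transpose, Matrix.smul_mul, Matrix.mul_smul, smul_smul,
      Real.mul_self_sqrt hμ.le, one_smul] at h
    exact h
  have t2 : ‖G * (Gᵀ * G * ((μ * μ) • B) * a)‖ ≤ ‖G‖ * (4 * c * q) := by
    have h := nm (le_refl ‖G‖) (nm (nm (nm (ntr hGn) hGn) (nsm (mul_nonneg hμ.le hμ.le) hBn)) han)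
    refine h.trans (mul_le_mul_of_nonneg_left ?_ hg0)
    have : 2 * s0 * 1 * (2 * s0 * 1) * (μ * μ * (1 * N * 1)) * (1 * 1) = 4 * ((μ * N) * (μ * N)) := by
      rw [← hN]; ring
    linarith
  have hY : Z * Qtp = LXp * (LXpᵀ * (Z * Qtp)) := by
    have : (LX * LXᵀ + LXp * LXpᵀ) * (Z * Qtp) = Z * Qtp := by rw [hL, Matrix.one_mul]
    rw [Matrix.add_mul, Matrix.mul_assoc LX, hLY, Matrix.mul_zero, zero_add,
      Matrix.mul_assoc LXp] at this
    exact this.symm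
  have hUY : ‖Uᵀ * (Z * Qtp)‖ ≤ c * (1 * ‖Z * Qtp‖) := by
    have : Uᵀ * (Z * Qtp) = (LXpᵀ * U)ᵀ * (LXpᵀ * (Z * Qtp)) := by
      rw [transpose_mul, transpose_transpose, Matrix.mul_assoc, ← hY]
    rw [this]
    exact nm (ntr hJ) (nm (ntr hLXpn) le_rfl)
  have hGUZ : G * (Uᵀ * Z) = Ztᵀ * Z * Qt * Qtᵀ + G * (Uᵀ * (Z * Qtp)) * Qtpᵀ := by
    have e1 : U * (Uᵀ * (Z * Qt)) = Z * Qt := by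
      rw [hUS, ← Matrix.mul_assoc Uᵀ, hU, Matrix.one_mul]
    have e2 : Uᵀ * Z = Uᵀ * (Z * Qt) * Qtᵀ + Uᵀ * (Z * Qtp) * Qtpᵀ := by
      have : Uᵀ * Z * (Qt * Qtᵀ + Qtp * Qtpᵀ) = Uᵀ * Z := by rw [hQ, Matrix.mul_one]
      rw [← this, Matrix.mul_add]
      simp only [Matrix.mul_assoc]
    rw [e2, Matrix.mul_add]
    congr 1
    · rw [hG, ← Matrix.mul_assoc, Matrix.mul_assoc Ztᵀ, e1]
      simp only [Matrix.mul_assoc]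
    · simp only [Matrix.mul_assoc]
  have t3 : ‖μ • (G * K * a)‖ ≤ 2 * μ * ‖Ztᵀ * Z‖ * s0 + 4 * μ * N * ‖Z * Qtp‖ := by
    have h1 : ‖G * (Uᵀ * Z)‖ ≤ ‖Ztᵀ * Z‖ + 2 * s0 * c * ‖Z * Qtp‖ := by
      rw [hGUZ]
      have a1 := nm (nm (le_refl ‖Ztᵀ * Z‖) (north hQt)) (ntr (north hQt))
      have a2 := nm (nm hGn hUY) (ntr (north hQtp))
      refine (norm_add_le _ _).trans ?_
      linarith
    have h2 : G * K * a = G * (Uᵀ * Z) * (Zᵀ * U) * a := by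
      rw [hK]; simp only [Matrix.mul_assoc]
    rw [h2]
    have h3 := nsm hμ.le (nm (nm h1 (nm (ntr hZ) hUn)) han)
    refine h3.trans ?_
    have e1 : μ * ((‖Ztᵀ * Z‖ + 2 * s0 * c * ‖Z * Qtp‖) * (2 * s0 * 1) * (1 * 1))
      = 2 * μ * ‖Ztᵀ * Z‖ * s0 + c * (4 * μ * N * ‖Z * Qtp‖) := by rw [← hN]; ring
    rw [e1]
    have : 0 ≤ 4 * μ * N * ‖Z * Qtp‖ := by positivity
    rw [hc]; linarith
  have t4 : ‖G * (μ • (Uᵀ * Δ * U * a))‖ ≤ ‖G‖ * (c * q) := by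
    have h := nm (le_refl ‖G‖) (nsm hμ.le (nm (nm (nm (ntr hUn) hΔ) hUn) han))
    refine h.trans (le_of_eq ?_)
    rw [hqd]; ring
  have t5 : ‖G * err‖ ≤ ‖G‖ * (600 * c * q) := nm le_rfl herrn
  have t6 : ‖Ztᵀ * F * w‖ ≤ e := by
    have := nm hZF hwn
    linarith
  have t7 : ‖(μ * μ) • (Ztᵀ * M * M * (U + F) * w)‖ ≤ 800 * μ ^ 2 * (N ^ 2 * s0) := by
    have h1 : ‖U + F‖ ≤ 2 := by
      refine (norm_add_le _ _).trans ?_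
      rw [hc] at *
      nlinarith
    refine (nsm (mul_nonneg hμ.le hμ.le) (nm (nm (nm (nm (ntr hZt) hMn) hMn) h1) hwn)).trans
      (le_of_eq ?_)
    ring
  have hfin : ((1 - μ • M) * Zt)ᵀ * P = G * w + Ztᵀ * F * w
      - (μ * μ) • (Ztᵀ * M * M * (U + F) * w) := by
    rw [hPw, transpose_mul, transpose_sub, transpose_smul, hMT, transpose_one, hG]
    simp only [Matrix.mul_add, Matrix.add_mul, Matrix.mul_sub, Matrix.sub_mul, Matrix.mul_assoc,
      Matrix.smul_mul, Matrix.mul_smul, Matrix.one_mul, Matrix.mul_one, smul_sub, smul_add, smul_smul]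
    abel
  rw [hfin, hGw]
  refine (norm_sub_le _ _).trans ?_
  refine (add_le_add_left (norm_add_le _ _) _).trans ?_
  refine (add_le_add_left (add_le_add_left (norm_add_le _ _) _) _).trans ?_
  refine (add_le_add_left (add_le_add_left (add_le_add_left (norm_sub_le _ _) _) _) _).trans ?_
  refine (add_le_add_left (add_le_add_left (add_le_add_left (add_le_add_left (norm_add_le _ _) _) _) _) _).trans ?_
  refine (add_le_add_left (add_le_add_left (add_le_add_left (add_le_add_left (add_le_add_left (norm_sub_le _ _) _) _) _) _) _).trans ?_
  have hfinal : ‖G‖ * (1 - q + 2 * c * q + 4 * c * q + c * q + 600 * c * q) ≤ ‖G‖ * (1 - q / 4) := by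
    apply mul_le_mul_of_nonneg_left _ hg0
    rw [hc]; linarith
  have : (1 - μ / 4 * σ) * ‖G‖ = ‖G‖ * (1 - q / 4) := by rw [hqd]; ring
  rw [this]
  nlinarith

end core

section glue
variable {ι κ₁ κ₂ : Type*} [Fintype ι] [Fintype κ₁] [Fintype κ₂] [DecidableEq ι] [DecidableEq κ₁] [DecidableEq κ₂]

lemma complete_of_orth (P : Matrix ι κ₁ ℝ) (Q : Matrix ι κ₂ ℝ) (hP : Pᵀ * P = 1) (hQ : Qᵀ * Q = 1)
    (hPQ : Pᵀ * Q = 0) (hc : Fintype.card κ₁ + Fintype.card κ₂ = Fintype.card ι) :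
    P * Pᵀ + Q * Qᵀ = 1 := by
  have hQP : Qᵀ * P = 0 := by
    have := congrArg Matrix.transpose hPQ
    simpa using this
  have h1 : (fromCols P Q)ᵀ * fromCols P Q = 1 := by
    rw [transpose_fromCols, fromRows_mul_fromCols, hP, hQ, hPQ, hQP, fromBlocks_one]
  have h2 : fromCols P Q * (fromCols P Q)ᵀ = 1 :=
    (Matrix.mul_eq_one_comm_of_card_eq _ _ _ (by simp [hc])).1 h1
  rwa [transpose_fromCols, fromCols_mul_fromRows] at h2

lemma card_le_of_orth (P : Matrix ι κ₁ ℝ) (hP : Pᵀ * P = 1) : Fintype.card κ₁ ≤ Fintype.card ι := by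
  have h1 := Matrix.rank_mul_le_right Pᵀ P
  rw [hP, Matrix.rank_one] at h1
  exact h1.trans (Matrix.rank_le_card_height P)

lemma sigmaMin_facts [Nonempty κ₁] (M U : Matrix ι κ₁ ℝ) (C S : Matrix κ₁ κ₁ ℝ) (hU : Uᵀ * U = 1)
    (hUM : U = M * C) (hM : M = U * S) (hCS : C * S = 1)
    (hc : Fintype.card κ₁ < Fintype.card ι) :
    0 < sigmaMin M ∧ ‖C‖ ≤ (sigmaMin M)⁻¹ := by
  have hUn := north hU
  have hUx : ∀ x, euclNorm (U *ᵥ x) = euclNorm x := by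
    intro x
    apply (sq_eq_sq₀ (eucl_nonneg _) (eucl_nonneg _)).1
    rw [eucl_sq, eucl_sq, Matrix.dotProduct_mulVec, ← Matrix.mulVec_transpose, Matrix.mulVec_mulVec,
      hU, Matrix.one_mulVec]
  have hMx : ∀ x, euclNorm x ≤ ‖C‖ * euclNorm (M *ᵥ x) := by
    intro x
    have : x = C *ᵥ (S *ᵥ x) := by rw [Matrix.mulVec_mulVec, hCS, Matrix.one_mulVec]
    rw [hM, ← Matrix.mulVec_mulVec, hUx]
    conv_lhs => rw [this]
    exact mulVec_le _ _
  have hne : {c : ℝ | ∃ x : κ₁ → ℝ, euclNorm x = 1 ∧ c = euclNorm (M.mulVec x)}.Nonempty := by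
    obtain ⟨i⟩ := ‹Nonempty κ₁›
    exact ⟨_, Pi.single i 1, by
      apply (sq_eq_sq₀ (eucl_nonneg _) zero_le_one).1
      rw [eucl_sq]; simp, rfl⟩
  have hCp : 0 < ‖C‖ := by
    obtain ⟨_, x, hx, -⟩ := hne
    have := hMx x
    rw [hx] at this
    rcases (norm_nonneg C).lt_or_eq with h | h
    · exact h
    · rw [← h] at this; linarith
  have hcol : ‖C‖⁻¹ ≤ sInf {c : ℝ | ∃ x : κ₁ → ℝ, euclNorm x = 1 ∧ c = euclNorm (M.mulVec x)} := by
    apply le_csInf hne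
    rintro _ ⟨x, hx, rfl⟩
    have := hMx x
    rw [hx] at this
    rwa [inv_le_iff_one_le_mul₀' hCp]
  have hrow : sInf {c : ℝ | ∃ y : ι → ℝ, euclNorm y = 1 ∧ c = euclNorm (Mᵀ.mulVec y)} ≤ 0 := by
    have hk : LinearMap.ker (Mᵀ.mulVecLin) ≠ ⊥ := by
      apply LinearMap.ker_ne_bot_of_finrank_lt
      simpa using hc
    obtain ⟨y, hy, hy0⟩ := (Submodule.ne_bot_iff _).1 hk
    rw [LinearMap.mem_ker, Matrix.mulVecLin_apply] at hy
    have hyn : euclNorm y ≠ 0 := fun h => hy0 (eucl_eq_zero h)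
    have hyp : 0 < euclNorm y := lt_of_le_of_ne (eucl_nonneg y) (Ne.symm hyn)
    apply csInf_le
    · exact ⟨0, by rintro _ ⟨x, -, rfl⟩; exact eucl_nonneg _⟩
    · refine ⟨(euclNorm y)⁻¹ • y, ?_, ?_⟩
      · rw [eucl_smul, abs_of_pos (inv_pos.2 hyp), inv_mul_cancel₀ hyn]
      · rw [Matrix.mulVec_smul, hy, smul_zero, eucl_zero]
  have hcp : 0 < sInf {c : ℝ | ∃ x : κ₁ → ℝ, euclNorm x = 1 ∧ c = euclNorm (M.mulVec x)} :=
    (inv_pos.2 hCp).trans_le hcol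
  have hs : sigmaMin M = sInf {c : ℝ | ∃ x : κ₁ → ℝ, euclNorm x = 1 ∧ c = euclNorm (M.mulVec x)} :=
    max_eq_left (hrow.trans hcp.le)
  have hsp : 0 < sigmaMin M := by rw [hs]; exact hcp
  refine ⟨hsp, norm_le_of_vec _ _ (inv_nonneg.2 hsp.le) fun x => ?_⟩
  have key : ∀ v, sigmaMin M * euclNorm v ≤ euclNorm (M *ᵥ v) := by
    intro v
    by_cases hv : euclNorm v = 0
    · rw [hv, mul_zero]; exact eucl_nonneg _
    have hvp : 0 < euclNorm v := lt_of_le_of_ne (eucl_nonneg v) (Ne.symm hv)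
    have : sigmaMin M ≤ euclNorm (M *ᵥ ((euclNorm v)⁻¹ • v)) := by
      rw [hs]
      apply csInf_le
      · exact ⟨0, by rintro _ ⟨x, -, rfl⟩; exact eucl_nonneg _⟩
      · exact ⟨_, by rw [eucl_smul, abs_of_pos (inv_pos.2 hvp), inv_mul_cancel₀ hv], rfl⟩
    rw [Matrix.mulVec_smul, eucl_smul, abs_of_pos (inv_pos.2 hvp), inv_mul_eq_div,
      le_div_iff₀ hvp] at this
    exact this
  have := key (C *ᵥ x)
  rw [Matrix.mulVec_mulVec, ← hUM, hUx] at this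
  rw [inv_mul_eq_div, le_div_iff₀ hsp]
  linarith

end glue

section stack
variable {n₁ n₂ m k r k' : ℕ}

lemma half2 : (Real.sqrt 2)⁻¹ * (Real.sqrt 2)⁻¹ = (1 / 2 : ℝ) := by
  rw [← mul_inv, Real.mul_self_sqrt (by norm_num)]; norm_num

lemma stackT_mul (V : Matrix (Fin n₁) (Fin k) ℝ) (W : Matrix (Fin n₂) (Fin k) ℝ)
    (V' : Matrix (Fin n₁) (Fin k') ℝ) (W' : Matrix (Fin n₂) (Fin k') ℝ) :
    (Zstack V W)ᵀ * Zstack V' W' = (1 / 2 : ℝ) • (Vᵀ * V' + Wᵀ * W') := by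
  rw [Zstack, Zstack, transpose_smul, Matrix.smul_mul, Matrix.mul_smul, smul_smul, half2,
    transpose_fromRows, fromCols_mul_fromRows]

lemma stack_mulT (V V' : Matrix (Fin n₁) (Fin k) ℝ) (W W' : Matrix (Fin n₂) (Fin k) ℝ) :
    Zstack V W * (Zstack V' W')ᵀ =
      (1 / 2 : ℝ) • fromBlocks (V * V'ᵀ) (V * W'ᵀ) (W * V'ᵀ) (W * W'ᵀ) := by
  rw [Zstack, Zstack, transpose_smul, Matrix.smul_mul, Matrix.mul_smul, smul_smul, half2,
    transpose_fromRows, fromRows_mul_fromCols]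

lemma stack_mul (V : Matrix (Fin n₁) (Fin k) ℝ) (W : Matrix (Fin n₂) (Fin k) ℝ)
    (D : Matrix (Fin k) (Fin k') ℝ) : Zstack V W * D = Zstack (V * D) (W * D) := by
  rw [Zstack, Zstack, Matrix.smul_mul, fromRows_mul]

lemma sym_mul_stack (G : Matrix (Fin n₁) (Fin n₂) ℝ) (V : Matrix (Fin n₁) (Fin k) ℝ)
    (W : Matrix (Fin n₂) (Fin k) ℝ) : symMat G * Zstack V W = Zstack (G * W) (Gᵀ * V) := by
  rw [Zstack, Zstack, Matrix.mul_smul, symMat, fromBlocks_mul_fromRows]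
  simp

lemma stack_sub (V V' : Matrix (Fin n₁) (Fin k) ℝ) (W W' : Matrix (Fin n₂) (Fin k) ℝ) :
    Zstack (V - V') (W - W') = Zstack V W - Zstack V' W' := by
  rw [Zstack, Zstack, Zstack, ← smul_sub]
  congr 1
  ext i j
  cases i <;> simp

lemma stack_smul (a : ℝ) (V : Matrix (Fin n₁) (Fin k) ℝ) (W : Matrix (Fin n₂) (Fin k) ℝ) :
    Zstack (a • V) (a • W) = a • Zstack V W := by
  rw [Zstack, Zstack, smul_comm]
  congr 1
  ext i j
  cases i <;> simp

lemma BB_sym (A : Fin m → Matrix (Fin n₁) (Fin n₂) ℝ) (Y : Matrix (Fin n₁) (Fin n₂) ℝ) :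
    BstarB A (symMat Y) = symMat (AstarA A Y) := by
  have hm : ∀ i, minner (Bmat A i) (symMat Y) = (Real.sqrt 2)⁻¹ * (2 * minner (A i) Y) := by
    intro i
    simp only [minner, Bmat, symMat, Fintype.sum_sum_type, Matrix.smul_apply, fromBlocks_apply₁₁,
      fromBlocks_apply₁₂, fromBlocks_apply₂₁, fromBlocks_apply₂₂, Matrix.zero_apply, smul_eq_mul,
      mul_zero, Finset.sum_const_zero, zero_add, add_zero, Matrix.transpose_apply]
    rw [Finset.sum_comm (s := (Finset.univ : Finset (Fin n₂)))]
    simp only [mul_assoc, ← Finset.mul_sum]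
    ring
  have h1 : ∀ i, minner (Bmat A i) (symMat Y) • Bmat A i =
      symMat (minner (A i) Y • A i) := by
    intro i
    rw [hm, Bmat, smul_smul]
    have : (Real.sqrt 2)⁻¹ * (2 * minner (A i) Y) * (Real.sqrt 2)⁻¹ = minner (A i) Y := by
      rw [mul_right_comm, half2]; ring
    rw [this, symMat, fromBlocks_smul]
    simp
  rw [BstarB, Finset.sum_congr rfl fun i _ => h1 i, AstarA]
  ext i j
  rw [Matrix.sum_apply]
  cases i <;> cases j <;> simp [symMat, Matrix.sum_apply]

lemma upd (A : Fin m → Matrix (Fin n₁) (Fin n₂) ℝ) (X : Matrix (Fin n₁) (Fin n₂) ℝ)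
    (μ : ℝ) (V₀ : Matrix (Fin n₁) (Fin k) ℝ) (W₀ : Matrix (Fin n₂) (Fin k) ℝ) (t : ℕ)
    (M : Matrix (Fin n₁ ⊕ Fin n₂) (Fin n₁ ⊕ Fin n₂) ℝ)
    (hM : M = symMat X - Zit A X μ V₀ W₀ t * (Zit A X μ V₀ W₀ t)ᵀ
      + Ztil A X μ V₀ W₀ t * (Ztil A X μ V₀ W₀ t)ᵀ + Δit A X μ V₀ W₀ t) :
    Mᵀ = M ∧ Zit A X μ V₀ W₀ (t + 1) = (1 + μ • M) * Zit A X μ V₀ W₀ t ∧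
      Ztil A X μ V₀ W₀ (t + 1) = (1 - μ • M) * Ztil A X μ V₀ W₀ t := by
  set V := (iter A X μ V₀ W₀ t).1 with hV
  set W := (iter A X μ V₀ W₀ t).2 with hW
  have hD : Zit A X μ V₀ W₀ t * (Zit A X μ V₀ W₀ t)ᵀ
      - Ztil A X μ V₀ W₀ t * (Ztil A X μ V₀ W₀ t)ᵀ - symMat X = symMat (V * Wᵀ - X) := by
    rw [Zit, Ztil, ← hV, ← hW, stack_mulT, stack_mulT, ← smul_sub]
    ext i j
    cases i <;> cases j <;> simp [symMat, Matrix.mul_apply, mul_comm] <;> ring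
  have hM2 : M = -symMat (AstarA A (V * Wᵀ - X)) := by
    rw [hM, Δit]
    rw [hD, BB_sym, ← hD]
    abel
  set G := AstarA A (V * Wᵀ - X) with hG
  have hi : iter A X μ V₀ W₀ (t + 1) = (V - μ • (G * W), W - μ • (Gᵀ * V)) := rfl
  refine ⟨?_, ?_, ?_⟩
  · rw [hM2, transpose_neg, symMat, fromBlocks_transpose]; simp
  · rw [Zit, hi, Zit, ← hV, ← hW, hM2, smul_neg, Matrix.add_mul, Matrix.one_mul, Matrix.neg_mul,
      Matrix.smul_mul, sym_mul_stack, stack_sub, stack_smul]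
    abel
  · rw [Ztil, hi, Ztil, ← hV, ← hW, hM2, smul_neg, Matrix.sub_mul, Matrix.one_mul, Matrix.neg_mul,
      Matrix.smul_mul, sym_mul_stack, ← stack_smul, sub_neg_eq_add]
    simp only [Zstack]
    rw [← smul_add]
    congr 1
    ext i j
    cases i <;> simp <;> ring

lemma sym_norm (X : Matrix (Fin n₁) (Fin n₂) ℝ) : ‖symMat X‖ ≤ ‖X‖ := by
  apply norm_le_of_vec _ _ (norm_nonneg _)
  intro v
  apply le_of_sq_le_sq _ (mul_nonneg (norm_nonneg _) (eucl_nonneg v))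
  have hs : ∀ v : Fin n₁ ⊕ Fin n₂ → ℝ, euclNorm v ^ 2 =
      euclNorm (v ∘ Sum.inl) ^ 2 + euclNorm (v ∘ Sum.inr) ^ 2 := by
    intro v
    rw [eucl_sq, eucl_sq, eucl_sq]
    simp [dotProduct]
  have e : symMat X *ᵥ v = Sum.elim (X *ᵥ (v ∘ Sum.inr)) (Xᵀ *ᵥ (v ∘ Sum.inl)) := by
    rw [symMat, fromBlocks_mulVec]; simp
  rw [mul_pow, hs v, hs, e, Sum.elim_comp_inl, Sum.elim_comp_inr]
  have h1 := pow_le_pow_left₀ (eucl_nonneg _) (mulVec_le X (v ∘ Sum.inr)) 2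
  have h2 := pow_le_pow_left₀ (eucl_nonneg _) (mulVec_le Xᵀ (v ∘ Sum.inl)) 2
  rw [nT] at h2
  nlinarith

lemma sym_dec (P : Matrix (Fin n₁) (Fin r) ℝ) (Q : Matrix (Fin n₂) (Fin r) ℝ) (σ : Fin r → ℝ) :
    symMat (P * diagonal σ * Qᵀ) = Zstack P Q * diagonal σ * (Zstack P Q)ᵀ
      - Zstack P (-Q) * diagonal σ * (Zstack P (-Q))ᵀ := by
  rw [stack_mul, stack_mul, stack_mulT, stack_mulT, ← smul_sub]
  have h : (P * diagonal σ * Qᵀ)ᵀ = Q * diagonal σ * Pᵀ := by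
    rw [transpose_mul, transpose_mul, transpose_transpose, diagonal_transpose, Matrix.mul_assoc]
  rw [symMat, h, transpose_neg]
  ext i j
  cases i <;> cases j <;> simp only [Matrix.smul_apply, Matrix.sub_apply, fromBlocks_apply₁₁,
      fromBlocks_apply₁₂, fromBlocks_apply₂₁, fromBlocks_apply₂₂, Matrix.zero_apply, smul_eq_mul,
      Matrix.mul_neg, Matrix.neg_mul, Matrix.neg_apply] <;> ring

lemma sv_facts (X : Matrix (Fin n₁) (Fin n₂) ℝ)
    (P : Matrix (Fin n₁) (Fin r) ℝ) (Q : Matrix (Fin n₂) (Fin r) ℝ) (σ : Fin r → ℝ)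
    (hP : Pᵀ * P = 1) (hQ : Qᵀ * Q = 1) (hσ : ∀ i, 0 < σ i) (hX : X = P * diagonal σ * Qᵀ) (i : Fin r) :
    sigmaPos X ≤ σ i ∧ σ i ≤ ‖X‖ := by
  constructor
  · apply csInf_le
    · exact ⟨0, by rintro _ ⟨x, -, -, rfl⟩; exact eucl_nonneg _⟩
    · have hone : ∀ {N : ℕ} (U : Matrix (Fin N) (Fin r) ℝ), Uᵀ * U = 1 → ∀ x,
          euclNorm (U *ᵥ x) = euclNorm x := by
        intro N U hU x
        apply (sq_eq_sq₀ (eucl_nonneg _) (eucl_nonneg _)).1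
        rw [eucl_sq, eucl_sq, Matrix.dotProduct_mulVec, ← Matrix.mulVec_transpose,
          Matrix.mulVec_mulVec, hU, Matrix.one_mulVec]
      refine ⟨Q *ᵥ Pi.single i 1, ?_, ?_, ?_⟩
      · rw [hone Q hQ]
        apply (sq_eq_sq₀ (eucl_nonneg _) zero_le_one).1
        rw [eucl_sq]; simp
      · intro y hy
        have h1 : Pᵀ *ᵥ (X *ᵥ y) = diagonal σ *ᵥ (Qᵀ *ᵥ y) := by
          rw [hX, Matrix.mulVec_mulVec, Matrix.mulVec_mulVec, ← Matrix.mul_assoc,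
            ← Matrix.mul_assoc, hP, Matrix.one_mul]
        rw [hy, Matrix.mulVec_zero] at h1
        have h2 := congrFun h1 i
        rw [Matrix.mulVec_diagonal] at h2
        have h3 : (Qᵀ *ᵥ y) i = 0 := by
          rcases mul_eq_zero.1 h2.symm with h | h
          · exact absurd h (hσ i).ne'
          · exact h
        rw [dotProduct_comm, Matrix.dotProduct_mulVec, ← Matrix.mulVec_transpose]
        simp [h3]
      · rw [hX, Matrix.mulVec_mulVec, Matrix.mul_assoc, hQ, Matrix.mul_one, ← Matrix.mulVec_mulVec,
          hone P hP]
        symm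
        apply (sq_eq_sq₀ (eucl_nonneg _) (hσ i).le).1
        rw [eucl_sq]
        have : diagonal σ *ᵥ Pi.single i 1 = Pi.single i (σ i) := by
          ext j
          rw [Matrix.mulVec_diagonal]
          by_cases h : j = i
          · subst h; simp
          · simp [h]
        rw [this]; simp [sq]
  · have h1 : Pᵀ * X * Q = diagonal σ := by
      rw [hX, ← Matrix.mul_assoc, ← Matrix.mul_assoc, hP, Matrix.one_mul, Matrix.mul_assoc, hQ,
        Matrix.mul_one]
    have h2 := nm (nm (ntr (north hP)) (le_refl ‖X‖)) (north hQ)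
    rw [h1, Matrix.l2_opNorm_diagonal] at h2
    have h3 := norm_le_pi_norm σ i
    rw [Real.norm_of_nonneg (hσ i).le] at h3
    linarith

end stack
set_option maxHeartbeats 4000000 in
lemma main_aux
    (n₁ n₂ m k r : ℕ)
    (A : Fin m → Matrix (Fin n₁) (Fin n₂) ℝ) (X : Matrix (Fin n₁) (Fin n₂) ℝ)
    (PX : Matrix (Fin n₁) (Fin r) ℝ) (QX : Matrix (Fin n₂) (Fin r) ℝ) (σX : Fin r → ℝ)
    (hPX : PXᵀ * PX = 1) (hQX : QXᵀ * QX = 1)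
    (hσpos : ∀ i, 0 < σX i)
    (hXsvd : X = PX * Matrix.diagonal σX * QXᵀ)
    (μ : ℝ) (hμ : 0 < μ)
    (V₀ : Matrix (Fin n₁) (Fin k) ℝ) (W₀ : Matrix (Fin n₂) (Fin k) ℝ)
    (Z Z' : ℕ → Matrix (Fin n₁ ⊕ Fin n₂) (Fin k) ℝ)
    (hZ : Z = Zit A X μ V₀ W₀) (hZ' : Z' = Ztil A X μ V₀ W₀)
    (LX : Matrix (Fin n₁ ⊕ Fin n₂) (Fin r) ℝ) (hLX : LX = Zstack PX QX)
    (κ σm : ℝ) (hκ : κ = condNum X) (hσm : σm = sigmaPos X)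
    (Δ : ℕ → Matrix (Fin n₁ ⊕ Fin n₂) (Fin n₁ ⊕ Fin n₂) ℝ) (hΔ : Δ = Δit A X μ V₀ W₀)
    (LXp : Matrix (Fin n₁ ⊕ Fin n₂) (Fin (n₁ + n₂ - r)) ℝ)
    (hLXp1 : LXpᵀ * LXp = 1) (hLXp2 : LXᵀ * LXp = 0)
    (t : ℕ)
    (Qt : Matrix (Fin k) (Fin r) ℝ) (hQt1 : Qtᵀ * Qt = 1)
    (hQt2 : LXᵀ * Z t * Qt * Qtᵀ = LXᵀ * Z t)
    (Qtp : Matrix (Fin k) (Fin (k - r)) ℝ) (hQtp1 : Qtpᵀ * Qtp = 1) (hQtp2 : Qtᵀ * Qtp = 0)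
    (Qs : Matrix (Fin k) (Fin r) ℝ)
    (hQs2 : LXᵀ * Z (t + 1) * Qs * Qsᵀ = LXᵀ * Z (t + 1))
    (PZ : Matrix (Fin n₁ ⊕ Fin n₂) (Fin r) ℝ) (hPZ : IsOrthCol PZ (Z t * Qt))
    (PZs : Matrix (Fin n₁ ⊕ Fin n₂) (Fin r) ℝ) (hPZs : IsOrthCol PZs (Z (t + 1) * Qs))
    (c : ℝ) (hc : c = 1 / 10000)
    (h1 : specNorm (Z t) ≤ 2 * Real.sqrt (specNorm X))
    (h2 : specNorm (Z t * Qtp) ≤ min (2 * sigmaMin (Z t * Qt)) (c * Real.sqrt σm))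
    (h3 : specNorm (Δ t) ≤ c * σm)
    (h4 : μ ≤ c / (specNorm X * κ))
    (h5 : specNorm ((Z' t)ᵀ * Z t * Qtp) ≤ c / κ * sigmaMin (Z t * Qt) * Real.sqrt (specNorm X))
    (h6 : specNorm (LXpᵀ * PZ) ≤ c / κ) :
    specNorm ((Z' (t + 1))ᵀ * PZs)
      ≤ (1 - μ / 4 * σm) * specNorm ((Z' t)ᵀ * PZ)
        + 4 * μ * specNorm X * specNorm (Z t * Qtp)
        + 2 * μ * specNorm ((Z' t)ᵀ * Z t) * Real.sqrt (specNorm X)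
        + μ * specNorm ((Z' t)ᵀ * Z t * Qtp) * σm / sigmaMin (Z t * Qt)
        + 800 * μ ^ 2 * specNorm X ^ ((5 : ℝ) / 2) := by
  simp only [specNorm_eq] at h1 h2 h3 h4 h5 h6 ⊢
  have hcp : 0 < c := by rw [hc]; norm_num
  -- positivity of the norms
  have hκ' : κ = ‖X‖ / σm := by rw [hκ, condNum, specNorm_eq, hσm]
  have hσ0 : 0 ≤ σm := by
    rw [hσm]
    apply Real.sInf_nonneg
    rintro _ ⟨x, -, -, rfl⟩
    exact eucl_nonneg _
  have hpos : 0 < c / (‖X‖ * κ) := hμ.trans_le h4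
  have hN : 0 < ‖X‖ := by
    rcases (norm_nonneg X).lt_or_eq with h | h
    · exact h
    · rw [← h] at hpos; simp at hpos
  have hσp : 0 < σm := by
    rcases hσ0.lt_or_eq with h | h
    · exact h
    · rw [hκ', ← h] at hpos; simp at hpos
  have hκp : 0 < κ := by rw [hκ']; positivity
  have hr : 0 < r := by
    rcases Nat.eq_zero_or_pos r with h | h
    · exfalso
      subst h
      have : X = 0 := by
        rw [hXsvd]; ext i j; simp [Matrix.mul_apply]
      rw [this, norm_zero] at hN
      exact lt_irrefl _ hN
    · exact h
  haveI : Nonempty (Fin r) := ⟨⟨0, hr⟩⟩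
  have hsv := sv_facts X PX QX σX hPX hQX hσpos hXsvd
  rw [← hσm] at hsv
  have hσN : σm ≤ ‖X‖ := (hsv ⟨0, hr⟩).1.trans (hsv ⟨0, hr⟩).2
  -- dimensions
  have hr1 : r ≤ n₁ := by simpa using card_le_of_orth PX hPX
  have hr2 : r ≤ n₂ := by simpa using card_le_of_orth QX hQX
  have hrk : r ≤ k := by simpa using card_le_of_orth Qt hQt1
  -- LX
  have hLX1 : LXᵀ * LX = 1 := by
    rw [hLX, stackT_mul, hPX, hQX, ← two_smul ℝ, smul_smul]; norm_num
  set Lt := Zstack PX (-QX) with hLt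
  have hLt1 : Ltᵀ * Lt = 1 := by
    rw [hLt, stackT_mul, transpose_neg, Matrix.neg_mul, Matrix.mul_neg, neg_neg, hPX, hQX,
      ← two_smul ℝ, smul_smul]; norm_num
  have hLtL : Ltᵀ * LX = 0 := by
    rw [hLX, hLt, stackT_mul, transpose_neg, Matrix.neg_mul, hPX, hQX]; simp
  have hLLt : LXᵀ * Lt = 0 := by
    rw [hLX, hLt, stackT_mul, Matrix.mul_neg, hPX, hQX]; simp
  have hL : LX * LXᵀ + LXp * LXpᵀ = 1 :=
    complete_of_orth LX LXp hLX1 hLXp1 hLXp2 (by simp; omega)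
  have hQ : Qt * Qtᵀ + Qtp * Qtpᵀ = 1 :=
    complete_of_orth Qt Qtp hQt1 hQtp1 hQtp2 (by simp; omega)
  have hSX : symMat X = LX * diagonal σX * LXᵀ - Lt * diagonal σX * Ltᵀ := by
    rw [hXsvd, sym_dec, hLX]
  -- update
  obtain ⟨hMT, hZu, hZu'⟩ := upd A X μ V₀ W₀ t _ rfl
  have hZZ' : ‖Z' t‖ = ‖Z t‖ := by
    have e : (Z' t)ᵀ * Z' t = (Z t)ᵀ * Z t := by
      rw [hZ, hZ', Zit, Ztil, stackT_mul, stackT_mul]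
      simp
    have h := congrArg norm e
    rw [nTM, nTM] at h
    exact (mul_self_inj (norm_nonneg _) (norm_nonneg _)).1 h
  rw [← hZ, ← hZ', ← hΔ] at hZu hZu' hMT
  generalize hM : symMat X - Z t * (Z t)ᵀ + Z' t * (Z' t)ᵀ + Δ t = M at hMT hZu hZu'
  -- the frame U
  obtain ⟨hU, ⟨C, hC⟩, hUU⟩ := hPZ
  obtain ⟨hP, ⟨C2, hC2⟩, -⟩ := hPZs
  set S := PZᵀ * (Z t * Qt) with hS
  have hUS : Z t * Qt = PZ * S := by rw [hS, ← Matrix.mul_assoc, hUU]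
  have hSC : S * C = 1 := by rw [hS, Matrix.mul_assoc, ← hC, hU]
  have hCS : C * S = 1 := mul_eq_one_comm.1 hSC
  obtain ⟨hs, hCn⟩ := sigmaMin_facts (Z t * Qt) PZ C S hU hC hUS hCS (by simp; omega)
  set s := sigmaMin (Z t * Qt) with hsd
  -- scalars
  set N := ‖X‖ with hNd
  set s0 := Real.sqrt N with hs0
  have hs00 : 0 ≤ s0 := Real.sqrt_nonneg _
  have hs0N : s0 * s0 = N := Real.mul_self_sqrt hN.le
  have hε : N * (c / κ) = c * σm := by rw [hκ']; field_simp
  have hε0 : 0 ≤ c / κ := by positivity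
  have hεc : c / κ ≤ c := by
    have : N * (c / κ) ≤ N * c := by rw [hε]; nlinarith
    exact le_of_mul_le_mul_left this hN
  have hμ2 : μ * N * N ≤ c * σm := by
    have h := (le_div_iff₀ (by positivity)).1 h4
    have e : μ * N * N = μ * (N * κ) * σm := by rw [hκ']; field_simp
    rw [e]; gcongr
  have hμN : μ * N ≤ c := by
    have : μ * N * N ≤ c * N := hμ2.trans (by gcongr)
    exact le_of_mul_le_mul_right this hN
  have hqp : 0 < μ * σm := mul_pos hμ hσp
  have hZt : ‖Z' t‖ ≤ 2 * s0 := by rw [hZZ']; exact h1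
  have hLXpn := north hLXp1
  have hLY : LXᵀ * (Z t * Qtp) = 0 := by
    rw [← Matrix.mul_assoc, ← hQt2, Matrix.mul_assoc _ Qtᵀ, hQtp2, Matrix.mul_zero]
  have hSXn : ‖symMat X‖ ≤ N := sym_norm X
  have hMn : ‖M‖ ≤ 10 * N := by
    rw [← hM]
    have a1 := nm h1 (ntr h1)
    have a2 := nm hZt (ntr hZt)
    have := norm_add_le (symMat X - Z t * (Z t)ᵀ + Z' t * (Z' t)ᵀ) (Δ t)
    have := norm_add_le (symMat X - Z t * (Z t)ᵀ) (Z' t * (Z' t)ᵀ)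
    have := norm_sub_le (symMat X) (Z t * (Z t)ᵀ)
    have : 2 * s0 * (2 * s0) = 4 * N := by rw [← hs0N]; ring
    have : c * σm ≤ N := by rw [hc]; linarith
    linarith
  obtain ⟨D, hD, hDn⟩ := core_T LX PZ LXp (μ • M) hL (north hLX1) hU
    (by
      have := nsm hμ.le hMn
      rw [hc] at hμN
      linarith)
    (h6.trans (hεc.trans (by rw [hc]; norm_num)))
  have hK := core_K (symMat X) (Δ t) M LX Lt PZ LXp σX (Z t) (Z' t) Qt (Z t * Qtp) S s0 (c * σm)
    (c / κ) ‖Z t * Qtp‖ ‖(Z' t)ᵀ * Z t * Qtp‖ hSX hM.symm hL hLX1 hLLt hLXpn hU hQt1 hUS hQt2 hLY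
    h1 hZt hs00 h3 le_rfl (by rw [Matrix.mul_assoc]) h6 (by rw [hs0N, hε])
  have hb2 : ‖Z t * Qtp‖ ≤ 2 * s := h2.trans (min_le_left _ _)
  set b := ‖Z t * Qtp‖ with hb
  set d := ‖(Z' t)ᵀ * Z t * Qtp‖ with hd
  have hd0 : 0 ≤ d := norm_nonneg _
  have hb0 : 0 ≤ b := norm_nonneg _
  have hK' : ‖LXᵀ * M * (Z t * Qtp)‖ ≤ 12 * (c * σm) * s := by
    refine hK.trans ?_
    have a1 : 5 * (c * σm) * b ≤ 5 * (c * σm) * (2 * s) := by gcongr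
    have a2 : 2 * s0 * d ≤ 2 * s0 * (c / κ * s * s0) := by gcongr
    have a3 : 2 * s0 * (c / κ * s * s0) = 2 * (c * σm) * s := by rw [← hε, ← hs0N]; ring
    linarith
  obtain ⟨w, hw⟩ := core_struct LX (1 + μ • M) (Z t) Qt Qtp Qs PZ PZs C S D C2 hQ
    (by rw [← hZu]; exact hQs2) hUS hCS hD (by rw [← hZu]; exact hC2)
  set E := (C * (D * (LXᵀ * (1 + μ • M) * (Z t * Qtp))))ᵀ with hE
  have hEn : ‖E‖ ≤ 24 * c * (μ * σm) := by
    have e1 : LXᵀ * (1 + μ • M) * (Z t * Qtp) = μ • (LXᵀ * M * (Z t * Qtp)) := by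
      rw [Matrix.mul_add, Matrix.mul_one, Matrix.add_mul, hLY, zero_add, Matrix.mul_smul,
        Matrix.smul_mul]
    rw [hE, nT, e1]
    refine (nm hCn (nm hDn (nsm hμ.le hK'))).trans (le_of_eq ?_)
    field_simp
    ring
  have hF : ‖Z t * Qtp * E * C‖ ≤ 48 * c * (μ * σm) := by
    refine (nm (nm hb2 hEn) hCn).trans (le_of_eq ?_)
    field_simp
    ring
  have hZF : ‖(Z' t)ᵀ * (Z t * Qtp * E * C)‖ ≤ d * (24 * c * (μ * σm)) * s⁻¹ := by
    have e1 : (Z' t)ᵀ * (Z t * Qtp * E * C) = (Z' t)ᵀ * Z t * Qtp * E * C := by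
      simp only [Matrix.mul_assoc]
    rw [e1]
    exact nm (nm le_rfl hEn) hCn
  have hB := core_contr (symMat X) LX Lt PZ LXp σX N σm μ (c / κ) hSX hL hLtL (north hLt1) hLXpn hU
    (fun i => (hsv i).1) (fun i => (hsv i).2) hσp hσN hμ (hμN.trans (by rw [hc]; norm_num)) hε0
    (hεc.trans (by rw [hc]; norm_num)) (by rw [hε, hc]; linarith) h6
  have hB' : ‖1 - μ • (PZᵀ * symMat X * PZ)‖ ≤ 1 - μ * σm + 2 * c * (μ * σm) := by
    refine hB.trans ?_
    have : c / κ * (μ * σm) ≤ c * (μ * σm) := by gcongr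
    linarith
  have hfin := core_fin (symMat X) (Δ t) M PZ (Z t * Qtp * E * C) PZs w LX LXp (Z t) (Z' t) Qt Qtp S
    N s0 σm μ c _ (μ * d * σm / s) hc hM.symm hMT hSXn hs00 hs0N hσp hσN hμ hμ2 hU hP hw
    hQt1 hQtp1 hQ hL hLXpn hLY hUS h1 hZt h3 (h6.trans hεc) hB' hF hZF (by
      have e1 : 2 * (d * (24 * c * (μ * σm)) * s⁻¹) = (48 * c) * (μ * d * σm / s) := by
        field_simp; ring
      rw [e1]
      have : 0 ≤ μ * d * σm / s := by positivity
      rw [hc]; linarith)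
  rw [← hZu'] at hfin
  have hrp : N ^ ((5 : ℝ) / 2) = N ^ 2 * s0 := by
    rw [hs0, Real.sqrt_eq_rpow, ← Real.rpow_natCast, ← Real.rpow_add hN]
    norm_num
  rw [hrp]
  exact hfin

end Core

/-- control of the imbalance term parallel to the signal part. -/
theorem statement15_imbalance_signal :
    ∃ c : ℝ, 0 < c ∧
    ∀
    (n₁ n₂ m k r : ℕ)
    (A : Fin m → Matrix (Fin n₁) (Fin n₂) ℝ) (X : Matrix (Fin n₁) (Fin n₂) ℝ)
    (PX : Matrix (Fin n₁) (Fin r) ℝ) (QX : Matrix (Fin n₂) (Fin r) ℝ) (σX : Fin r → ℝ)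
    (hPX : PXᵀ * PX = 1) (hQX : QXᵀ * QX = 1)
    (hσpos : ∀ i, 0 < σX i) (hσanti : Antitone σX)
    (hXsvd : X = PX * Matrix.diagonal σX * QXᵀ)
    (μ : ℝ) (hμ : 0 < μ)
    (V₀ : Matrix (Fin n₁) (Fin k) ℝ) (W₀ : Matrix (Fin n₂) (Fin k) ℝ)
    (Z Z' : ℕ → Matrix (Fin n₁ ⊕ Fin n₂) (Fin k) ℝ)
    (hZ : Z = Zit A X μ V₀ W₀) (hZ' : Z' = Ztil A X μ V₀ W₀)
    (LX : Matrix (Fin n₁ ⊕ Fin n₂) (Fin r) ℝ) (hLX : LX = Zstack PX QX)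
    (κ σm : ℝ) (hκ : κ = condNum X) (hσm : σm = sigmaPos X)
    (Δ : ℕ → Matrix (Fin n₁ ⊕ Fin n₂) (Fin n₁ ⊕ Fin n₂) ℝ) (hΔ : Δ = Δit A X μ V₀ W₀)
    (LXp : Matrix (Fin n₁ ⊕ Fin n₂) (Fin (n₁ + n₂ - r)) ℝ)
    (hLXp1 : LXpᵀ * LXp = 1) (hLXp2 : LXᵀ * LXp = 0)
    (t : ℕ)
    (Qt : Matrix (Fin k) (Fin r) ℝ) (hQt1 : Qtᵀ * Qt = 1)
    (hQt2 : LXᵀ * Z t * Qt * Qtᵀ = LXᵀ * Z t)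
    (Qtp : Matrix (Fin k) (Fin (k - r)) ℝ) (hQtp1 : Qtpᵀ * Qtp = 1) (hQtp2 : Qtᵀ * Qtp = 0)
    (Qs : Matrix (Fin k) (Fin r) ℝ) (hQs1 : Qsᵀ * Qs = 1)
    (hQs2 : LXᵀ * Z (t + 1) * Qs * Qsᵀ = LXᵀ * Z (t + 1))
    (PZ : Matrix (Fin n₁ ⊕ Fin n₂) (Fin r) ℝ) (hPZ : IsOrthCol PZ (Z t * Qt))
    (PZs : Matrix (Fin n₁ ⊕ Fin n₂) (Fin r) ℝ) (hPZs : IsOrthCol PZs (Z (t + 1) * Qs))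
    (h1 : specNorm (Z t) ≤ 2 * Real.sqrt (specNorm X))
    (h2 : specNorm (Z t * Qtp) ≤ min (2 * sigmaMin (Z t * Qt)) (c * Real.sqrt σm))
    (h3 : specNorm (Δ t) ≤ c * σm)
    (h4 : μ ≤ c / (specNorm X * κ))
    (h5 : specNorm ((Z' t)ᵀ * Z t * Qtp) ≤ c / κ * sigmaMin (Z t * Qt) * Real.sqrt (specNorm X))
    (h6 : specNorm (LXpᵀ * PZ) ≤ c / κ),
    specNorm ((Z' (t + 1))ᵀ * PZs)
      ≤ (1 - μ / 4 * σm) * specNorm ((Z' t)ᵀ * PZ)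
        + 4 * μ * specNorm X * specNorm (Z t * Qtp)
        + 2 * μ * specNorm ((Z' t)ᵀ * Z t) * Real.sqrt (specNorm X)
        + μ * specNorm ((Z' t)ᵀ * Z t * Qtp) * σm / sigmaMin (Z t * Qt)
        + 800 * μ ^ 2 * specNorm X ^ ((5 : ℝ) / 2) := by
  refine ⟨1 / 10000, by norm_num, ?_⟩
  generalize hc : (1 / 10000 : ℝ) = c
  intro n₁ n₂ m k r A X PX QX σX hPX hQX hσpos _ hXsvd μ hμ V₀ W₀ Z Z' hZ hZ' LX hLX κ σm hκ hσm
    Δ hΔ LXp hLXp1 hLXp2 t Qt hQt1 hQt2 Qtp hQtp1 hQtp2 Qs hQs1 hQs2 PZ hPZ PZs hPZs h1 h2 h3 h4 h5 h6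
  exact main_aux n₁ n₂ m k r A X PX QX σX hPX hQX hσpos hXsvd μ hμ V₀ W₀ Z Z' hZ hZ' LX hLX κ σm hκ hσm
    Δ hΔ LXp hLXp1 hLXp2 t Qt hQt1 hQt2 Qtp hQtp1 hQtp2 Qs hQs2 PZ hPZ PZs hPZs c hc.symm
    h1 h2 h3 h4 h5 h6

end AsymMatrixSensing
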